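/- Let (E, 𝓛, 𝓑) be a weakly left-resolving labeled space, let {p_A : A ∈ 𝓑}, {s_a : a ∈ 𝒜} be a representation of (E, 𝓛, 𝓑) in a C*-algebra, let D be the C*-subalgebra generated by {p_A : A ∈ 𝓑} ∪ {s_a : a ∈ 𝒜}, and let A ∈ 𝓑 be a minimal sinks set. Then I_A := the closure of span{s_α p_A s_β* : α, β ∈ 𝓛^#(E)} is a closed two-sided ideal of D. -/

import Mathlib

universe u v w

/-- A labeled graph: a directed graph with source and range maps together with a
labeling of the edges by an alphabet `Λ` (onto, i.e. `Λ = 𝓛(E¹)`). -/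
structure LabeledGraph (V : Type u) (E : Type v) (Λ : Type w) where
  src : E → V
  rng : E → V
  lab : E → Λ
  lab_surj : Function.Surjective lab

namespace LabeledGraph

variable {V : Type u} {E : Type v} {Λ : Type w} (G : LabeledGraph V E Λ)

/-- A (finite, nonempty) path: a nonempty list of composable edges. -/
def IsPath (p : List E) : Prop :=
  p ≠ [] ∧ p.Chain' (fun e f => G.rng e = G.src f)

/-- The relative range `r(A, α)`. -/
def relRange (A : Set V) (α : List Λ) : Set V :=
  {v | ∃ p : List E, G.IsPath p ∧ p.map G.lab = α ∧
      (∃ e, p.head? = some e ∧ G.src e ∈ A) ∧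
      (∃ e, p.getLast? = some e ∧ G.rng e = v)}

/-- The range `r(α) = r(E⁰, α)`. -/
def range (α : List Λ) : Set V := G.relRange Set.univ α

/-- The source set `s(α)` of a word. -/
def srcSet (α : List Λ) : Set V :=
  {v | ∃ p : List E, G.IsPath p ∧ p.map G.lab = α ∧
      (∃ e, p.head? = some e ∧ G.src e = v)}

/-- `𝓛(A E¹)`: the labels of edges with source in `A`. -/
def labelSet (A : Set V) : Set Λ :=
  {a | ∃ e, G.src e ∈ A ∧ G.lab e = a}

/-- `𝓛*(E)`: the labels of finite nonempty paths. -/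
def words : Set (List Λ) :=
  {α | ∃ p : List E, G.IsPath p ∧ p.map G.lab = α}

/-- `𝓛^#(E) = 𝓛*(E) ∪ {ε}`. -/
def wordsHash : Set (List Λ) := insert [] G.words

/-- The set of sinks `E⁰_sink`. -/
def sinks : Set V := {v | ∀ e : E, G.src e ≠ v}

/-- `ℬ ⊆ 2^{E⁰}` is accommodating. -/
structure Accommodating (ℬ : Set (Set V)) : Prop where
  nonempty : ∃ A ∈ ℬ, A ≠ ∅
  range_mem : ∀ α ∈ G.words, G.range α ∈ ℬ
  relRange_mem : ∀ A ∈ ℬ, ∀ α ∈ G.words, G.relRange A α ∈ ℬ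
  inter_mem : ∀ A ∈ ℬ, ∀ B ∈ ℬ, A ∩ B ∈ ℬ
  union_mem : ∀ A ∈ ℬ, ∀ B ∈ ℬ, A ∪ B ∈ ℬ

/-- `(E, 𝓛, ℬ)` is weakly left-resolving. -/
def WeaklyLeftResolving (ℬ : Set (Set V)) : Prop :=
  ∀ A ∈ ℬ, ∀ B ∈ ℬ, ∀ α ∈ G.words,
    G.relRange (A ∩ B) α = G.relRange A α ∩ G.relRange B α

/-- `ℬ` is closed under relative complements (non-degeneracy). -/
def NonDegenerate (_G : LabeledGraph V E Λ) (ℬ : Set (Set V)) : Prop :=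
  ∀ A ∈ ℬ, ∀ B ∈ ℬ, A \ B ∈ ℬ

/-- A hereditary subset `ℋ` of `ℬ` (not containing `∅`). -/
structure Hereditary (ℬ ℋ : Set (Set V)) : Prop where
  subset : ℋ ⊆ ℬ
  empty_not_mem : ∅ ∉ ℋ
  relRange_mem : ∀ A ∈ ℋ, ∀ α ∈ G.words, G.relRange A α ≠ ∅ → G.relRange A α ∈ ℋ
  union_mem : ∀ A ∈ ℋ, ∀ B ∈ ℋ, A ∪ B ∈ ℋ
  mem_of_subset : ∀ A ∈ ℋ, ∀ B ∈ ℬ, B ≠ ∅ → B ⊆ A → B ∈ ℋ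

/-- A minimal sinks set. -/
def MinimalSinksSet (ℬ : Set (Set V)) (A : Set V) : Prop :=
  A ∈ ℬ ∧ A.Nonempty ∧ A ⊆ G.sinks ∧ ∀ B ∈ ℬ, A ⊆ B ∨ A ∩ B = ∅

end LabeledGraph

/-- A representation of the labeled space `(E, 𝓛, ℬ)` in a C*-algebra `B`. -/
structure LabeledSpaceRep {V : Type u} {E : Type v} {Λ : Type w}
    (G : LabeledGraph V E Λ) (ℬ : Set (Set V))
    (B : Type*) [CStarAlgebra B] where
  p : Set V → B
  s : Λ → B
  p_empty : p ∅ = 0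
  p_selfAdjoint : ∀ A ∈ ℬ, star (p A) = p A
  s_partialIsometry : ∀ a : Λ, s a * star (s a) * s a = s a
  p_inter : ∀ A ∈ ℬ, ∀ A' ∈ ℬ, p A * p A' = p (A ∩ A')
  p_union : ∀ A ∈ ℬ, ∀ A' ∈ ℬ, p (A ∪ A') = p A + p A' - p (A ∩ A')
  s_star_s : ∀ a b : Λ, star (s a) * s b = open Classical in if a = b then p (G.range [a]) else 0

  s_star_p : ∀ a : Λ, ∀ A ∈ ℬ, star (s a) * p A = p (G.relRange A [a]) * star (s a)
  p_sum : ∀ A ∈ ℬ, ∀ hfin : (G.labelSet A).Finite, A ∩ G.sinks = ∅ →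
      p A = ∑ a ∈ hfin.toFinset, s a * p (G.relRange A [a]) * star (s a)

namespace LabeledSpaceRep

variable {V : Type u} {E : Type v} {Λ : Type w}
  {G : LabeledGraph V E Λ} {ℬ : Set (Set V)}
  {B : Type*} [CStarAlgebra B]

/-- `s_μ = s_{a₁} ⋯ s_{aₙ}` for a word `μ = a₁ ⋯ aₙ`; `s_ε = 1`. -/
def sWord (ρ : LabeledSpaceRep G ℬ B) (μ : List Λ) : B := (μ.map ρ.s).prod

end LabeledSpaceRep

namespace LabeledGraph

variable {V : Type u} {E : Type v} {Λ : Type w} {G : LabeledGraph V E Λ}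

theorem singleton_mem_words (G : LabeledGraph V E Λ) (a : Λ) : [a] ∈ G.words := by
  obtain ⟨e, rfl⟩ := G.lab_surj a
  exact ⟨[e], ⟨by simp, List.isChain_singleton e⟩, rfl⟩

theorem mem_words_of_nonempty_relRange {C : Set V} {α : List Λ}
    (h : (G.relRange C α).Nonempty) : α ∈ G.words := by
  obtain ⟨_, p, hp, hl, -⟩ := h
  exact ⟨p, hp, hl⟩

theorem relRange_eq_empty_of_subset_sinks {A : Set V} (hA : A ⊆ G.sinks) (α : List Λ) :
    G.relRange A α = ∅ := by
  ext v
  simp only [Set.mem_empty_iff_false, iff_false]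
  rintro ⟨p, -, -, ⟨e, -, he⟩, -⟩
  exact hA he e rfl

theorem relRange_relRange_subset (C : Set V) (α β : List Λ) :
    G.relRange (G.relRange C α) β ⊆ G.relRange C (α ++ β) := by
  rintro v ⟨q, ⟨hq0, hq⟩, hql, ⟨f, hf, p, ⟨hp0, hp⟩, hpl, ⟨e, he, heC⟩, g, hg, hgf⟩, ⟨k, hk, hkv⟩⟩
  refine ⟨p ++ q, ⟨by simp [hp0], ?_⟩, by simp [hpl, hql],
    ⟨e, by simp [List.head?_append, he], heC⟩, ⟨k, by simp [List.getLast?_append, hk], hkv⟩⟩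
  refine List.isChain_append.2 ⟨hp, hq, ?_⟩
  intro x hx y hy
  rw [hg] at hx
  rw [hf] at hy
  simp only [Option.mem_def, Option.some.injEq] at hx hy
  rw [← hx, ← hy, hgf]

/-- The relative range computed one letter at a time. -/
def iterRange (G : LabeledGraph V E Λ) (C : Set V) (α : List Λ) : Set V :=
  α.foldl (fun C a => G.relRange C [a]) C

theorem iterRange_relRange_subset (C : Set V) (α β : List Λ) :
    G.iterRange (G.relRange C α) β ⊆ G.relRange C (α ++ β) := by
  induction β generalizing C α with
  | nil => simp [iterRange]
  | cons b β ih =>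
    have hmono : ∀ (β : List Λ) {C C' : Set V}, C ⊆ C' → G.iterRange C β ⊆ G.iterRange C' β := by
      intro β
      induction β with
      | nil => exact fun h => h
      | cons b β ih =>
        intro C C' h
        refine ih ?_
        rintro v ⟨p, hp, hl, ⟨e, he, heC⟩, hv⟩
        exact ⟨p, hp, hl, ⟨e, he, h heC⟩, hv⟩
    refine (hmono β (relRange_relRange_subset C α [b])).trans ?_
    simpa using ih C (α ++ [b])

theorem iterRange_mem {ℬ : Set (Set V)} (hacc : G.Accommodating ℬ) {C : Set V} (hC : C ∈ ℬ)
    (α : List Λ) : G.iterRange C α ∈ ℬ := by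
  induction α generalizing C with
  | nil => exact hC
  | cons a α ih => exact ih (hacc.relRange_mem C hC [a] (G.singleton_mem_words a))

theorem mem_wordsHash_of_cons {a : Λ} {α : List Λ} (h : a :: α ∈ G.wordsHash) :
    α ∈ G.wordsHash := by
  rcases h with h | ⟨p, ⟨hp0, hp⟩, hl⟩
  · simp at h
  · match p, hp0 with
    | e :: q, _ =>
      simp only [List.map_cons, List.cons.injEq] at hl
      by_cases hq : q = []
      · subst hq
        exact Or.inl hl.2.symm
      · exact Or.inr ⟨q, ⟨hq, List.IsChain.tail hp⟩, hl.2⟩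

end LabeledGraph

namespace LabeledSpaceRep

variable {V : Type u} {E : Type v} {Λ : Type w}
  {G : LabeledGraph V E Λ} {ℬ : Set (Set V)}
  {B : Type*} [CStarAlgebra B] (ρ : LabeledSpaceRep G ℬ B)

theorem sWord_nil : ρ.sWord [] = 1 := rfl

theorem sWord_cons (a : Λ) (α : List Λ) : ρ.sWord (a :: α) = ρ.s a * ρ.sWord α := by
  simp [sWord]

theorem p_mul_s (hacc : G.Accommodating ℬ) {C : Set V} (hC : C ∈ ℬ) (a : Λ) :
    ρ.p C * ρ.s a = ρ.s a * ρ.p (G.relRange C [a]) := by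
  have h := congrArg star (ρ.s_star_p a C hC)
  simpa [ρ.p_selfAdjoint C hC, ρ.p_selfAdjoint _
    (hacc.relRange_mem C hC [a] (G.singleton_mem_words a))] using h

theorem p_mul_sWord (hacc : G.Accommodating ℬ) {C : Set V} (hC : C ∈ ℬ) (α : List Λ) :
    ρ.p C * ρ.sWord α = ρ.sWord α * ρ.p (G.iterRange C α) := by
  induction α generalizing C with
  | nil => simp [sWord_nil, LabeledGraph.iterRange]
  | cons a α ih =>
    rw [sWord_cons, ← mul_assoc, ρ.p_mul_s hacc hC, mul_assoc,
      ih (hacc.relRange_mem C hC [a] (G.singleton_mem_words a)), ← mul_assoc]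
    rfl

theorem sWord_cons_eq_zero (hacc : G.Accommodating ℬ) {a : Λ} {α : List Λ}
    (h : a :: α ∉ G.words) : ρ.sWord (a :: α) = 0 := by
  have hempty : G.iterRange (G.range [a]) α = ∅ := by
    by_contra hne
    exact h (LabeledGraph.mem_words_of_nonempty_relRange
      ((Set.nonempty_iff_ne_empty.2 hne).mono (LabeledGraph.iterRange_relRange_subset _ [a] α)))
  have hs : ρ.s a = ρ.s a * ρ.p (G.range [a]) := by
    have := ρ.s_star_s a a
    rw [if_pos rfl] at this
    rw [← this, ← mul_assoc, ρ.s_partialIsometry]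
  rw [sWord_cons, hs, mul_assoc,
    ρ.p_mul_sWord hacc (hacc.range_mem _ (G.singleton_mem_words a)), hempty, ρ.p_empty]
  simp

/-- The linear span of the elements `s_α p_A s_β*`. -/
noncomputable def idealSpan (A : Set V) : Submodule ℂ B :=
  Submodule.span ℂ {x : B | ∃ α ∈ G.wordsHash, ∃ β ∈ G.wordsHash,
    x = ρ.sWord α * ρ.p A * star (ρ.sWord β)}

theorem mul_mem_idealSpan_of_forall {A : Set V} {d : B}
    (h : ∀ α ∈ G.wordsHash, d * (ρ.sWord α * ρ.p A) = 0 ∨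
      ∃ α' ∈ G.wordsHash, d * (ρ.sWord α * ρ.p A) = ρ.sWord α' * ρ.p A)
    {x : B} (hx : x ∈ ρ.idealSpan A) : d * x ∈ ρ.idealSpan A := by
  induction hx using Submodule.span_induction with
  | mem x hx =>
    obtain ⟨α, hα, β, hβ, rfl⟩ := hx
    rw [← mul_assoc]
    rcases h α hα with h | ⟨α', hα', h⟩
    · simp [h]
    · rw [h]
      exact Submodule.subset_span ⟨α', hα', β, hβ, rfl⟩
  | zero => simp
  | add x y _ _ hx hy => rw [mul_add]; exact add_mem hx hy
  | smul c x _ hx => rw [mul_smul_comm]; exact Submodule.smul_mem _ c hx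

theorem star_mem_idealSpan {A : Set V} (hA : A ∈ ℬ) {x : B} (hx : x ∈ ρ.idealSpan A) :
    star x ∈ ρ.idealSpan A := by
  induction hx using Submodule.span_induction with
  | mem x hx =>
    obtain ⟨α, hα, β, hβ, rfl⟩ := hx
    exact Submodule.subset_span
      ⟨β, hβ, α, hα, by simp [ρ.p_selfAdjoint A hA, mul_assoc]⟩
  | zero => simp
  | add x y _ _ hx hy => rw [star_add]; exact add_mem hx hy
  | smul c x _ hx => rw [star_smul]; exact Submodule.smul_mem _ _ hx

theorem p_mul_sWord_mul_p (hacc : G.Accommodating ℬ) {A C : Set V}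
    (hA : G.MinimalSinksSet ℬ A) (hC : C ∈ ℬ) (α : List Λ) :
    ρ.p C * (ρ.sWord α * ρ.p A) = 0 ∨
      ρ.p C * (ρ.sWord α * ρ.p A) = ρ.sWord α * ρ.p A := by
  have hC' := LabeledGraph.iterRange_mem hacc hC α
  rw [← mul_assoc, ρ.p_mul_sWord hacc hC, mul_assoc, ρ.p_inter _ hC' _ hA.1, Set.inter_comm]
  rcases hA.2.2.2 _ hC' with h | h
  · rw [Set.inter_eq_left.2 h]
    exact Or.inr rfl
  · simp [h, ρ.p_empty]

theorem p_mul_mem_idealSpan (hacc : G.Accommodating ℬ) {A C : Set V}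
    (hA : G.MinimalSinksSet ℬ A) (hC : C ∈ ℬ) {x : B} (hx : x ∈ ρ.idealSpan A) :
    ρ.p C * x ∈ ρ.idealSpan A :=
  ρ.mul_mem_idealSpan_of_forall
    (fun α hα => (ρ.p_mul_sWord_mul_p hacc hA hC α).imp_right fun h => ⟨α, hα, h⟩) hx

theorem s_mul_mem_idealSpan (hacc : G.Accommodating ℬ) {A : Set V} (a : Λ)
    {x : B} (hx : x ∈ ρ.idealSpan A) : ρ.s a * x ∈ ρ.idealSpan A := by
  refine ρ.mul_mem_idealSpan_of_forall (fun α _ => ?_) hx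
  rw [← mul_assoc, ← sWord_cons]
  by_cases h : a :: α ∈ G.words
  · exact Or.inr ⟨_, Or.inr h, rfl⟩
  · simp [ρ.sWord_cons_eq_zero hacc h]

theorem star_s_mul_mem_idealSpan (hacc : G.Accommodating ℬ) {A : Set V}
    (hA : G.MinimalSinksSet ℬ A) (a : Λ) {x : B} (hx : x ∈ ρ.idealSpan A) :
    star (ρ.s a) * x ∈ ρ.idealSpan A := by
  refine ρ.mul_mem_idealSpan_of_forall (fun α hα => ?_) hx
  cases α with
  | nil =>
    left
    rw [sWord_nil, one_mul, ρ.s_star_p a A hA.1,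
      LabeledGraph.relRange_eq_empty_of_subset_sinks hA.2.2.1, ρ.p_empty, zero_mul]
  | cons b α =>
    rw [sWord_cons, mul_assoc, ← mul_assoc, ρ.s_star_s]
    split_ifs with hab
    · exact (ρ.p_mul_sWord_mul_p hacc hA
        (hacc.range_mem _ (G.singleton_mem_words a)) α).imp_right
          fun h => ⟨α, LabeledGraph.mem_wordsHash_of_cons hα, h⟩
    · simp

/-- The `*`-algebra generated by a representation. -/
noncomputable def starAlg : NonUnitalStarSubalgebra ℂ B :=
  NonUnitalStarAlgebra.adjoin ℂ ({x | ∃ A' ∈ ℬ, x = ρ.p A'} ∪ Set.range ρ.s)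

theorem mul_mem_idealSpan (hacc : G.Accommodating ℬ) {A : Set V}
    (hA : G.MinimalSinksSet ℬ A) {d : B} (hd : d ∈ ρ.starAlg) {x : B} (hx : x ∈ ρ.idealSpan A) :
    d * x ∈ ρ.idealSpan A ∧ x * d ∈ ρ.idealSpan A := by
  have hright : ∀ {d : B}, (∀ y ∈ ρ.idealSpan A, star d * y ∈ ρ.idealSpan A) →
      ∀ y ∈ ρ.idealSpan A, y * d ∈ ρ.idealSpan A := by
    intro d h y hy
    simpa using ρ.star_mem_idealSpan hA.1 (h _ (ρ.star_mem_idealSpan hA.1 hy))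
  induction hd using NonUnitalStarAlgebra.adjoin_induction generalizing x with
  | mem d hd =>
    rcases hd with ⟨C, hC, rfl⟩ | ⟨a, rfl⟩
    · refine ⟨ρ.p_mul_mem_idealSpan hacc hA hC hx, hright (fun y hy => ?_) x hx⟩
      rw [ρ.p_selfAdjoint C hC]
      exact ρ.p_mul_mem_idealSpan hacc hA hC hy
    · exact ⟨ρ.s_mul_mem_idealSpan hacc a hx,
        hright (fun y hy => ρ.star_s_mul_mem_idealSpan hacc hA a hy) x hx⟩
  | zero => simp
  | add d e _ _ hd he =>
    rw [add_mul, mul_add]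
    exact ⟨add_mem (hd hx).1 (he hx).1, add_mem (hd hx).2 (he hx).2⟩
  | mul d e _ _ hd he =>
    rw [mul_assoc, ← mul_assoc x]
    exact ⟨(hd (he hx).1).1, (he (hd hx).2).2⟩
  | smul c d _ hd =>
    rw [smul_mul_assoc, mul_smul_comm]
    exact ⟨Submodule.smul_mem _ c (hd hx).1, Submodule.smul_mem _ c (hd hx).2⟩
  | star d _ hd =>
    refine ⟨?_, hright (fun y hy => by simpa using (hd hy).1) x hx⟩
    simpa using ρ.star_mem_idealSpan hA.1 (hd (ρ.star_mem_idealSpan hA.1 hx)).2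

theorem sWord_mul_mem_starAlg (α : List Λ) {x : B} (hx : x ∈ ρ.starAlg) :
    ρ.sWord α * x ∈ ρ.starAlg := by
  induction α with
  | nil => simpa [sWord_nil] using hx
  | cons a α ih =>
    rw [sWord_cons, mul_assoc]
    exact mul_mem (NonUnitalStarAlgebra.subset_adjoin ℂ _ (Or.inr ⟨a, rfl⟩)) ih

theorem idealSpan_subset_starAlg {A : Set V} (hA : A ∈ ℬ) :
    (ρ.idealSpan A : Set B) ⊆ ρ.starAlg := by
  intro x hx
  induction hx using Submodule.span_induction with
  | mem x hx =>
    obtain ⟨α, -, β, -, rfl⟩ := hx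
    have hp : ρ.p A ∈ ρ.starAlg :=
      NonUnitalStarAlgebra.subset_adjoin ℂ _ (Or.inl ⟨A, hA, rfl⟩)
    have h := star_mem (ρ.sWord_mul_mem_starAlg β hp)
    rw [star_mul, ρ.p_selfAdjoint A hA] at h
    rw [mul_assoc]
    exact ρ.sWord_mul_mem_starAlg α h
  | zero => exact zero_mem ρ.starAlg
  | add x y _ _ hx hy => exact add_mem (S := NonUnitalStarSubalgebra ℂ B) hx hy
  | smul c x _ hx => exact SMulMemClass.smul_mem (S := NonUnitalStarSubalgebra ℂ B) c hx

end LabeledSpaceRep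

theorem stmt16 {V : Type u} {E : Type v} {Λ : Type w}
    (G : LabeledGraph V E Λ) (ℬ : Set (Set V))
    (hacc : G.Accommodating ℬ) (hwlr : G.WeaklyLeftResolving ℬ)
    {B : Type*} [CStarAlgebra B] (ρ : LabeledSpaceRep G ℬ B)
    (A : Set V) (hA : G.MinimalSinksSet ℬ A)
    (D : Set B)
    (hD : D = closure (↑(NonUnitalStarAlgebra.adjoin ℂ
        ({x | ∃ A' ∈ ℬ, x = ρ.p A'} ∪ Set.range ρ.s)) : Set B))
    (I : Submodule ℂ B)
    (hI : I = (Submodule.span ℂ {x : B | ∃ α ∈ G.wordsHash, ∃ β ∈ G.wordsHash,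
        x = ρ.sWord α * ρ.p A * star (ρ.sWord β)}).topologicalClosure) :
    (↑I ⊆ D) ∧ ∀ d ∈ D, ∀ x ∈ I, d * x ∈ I ∧ x * d ∈ I := by
  subst hD hI
  refine ⟨closure_mono (ρ.idealSpan_subset_starAlg hA.1), fun d hd x hx => ⟨?_, ?_⟩⟩
  · exact map_mem_closure₂ continuous_mul hd hx
      fun d hd x hx => (ρ.mul_mem_idealSpan hacc hA hd hx).1
  · exact map_mem_closure₂ continuous_mul hx hd
      fun x hx d hd => (ρ.mul_mem_idealSpan hacc hA hd hx).2
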